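/- For every n ≥ 2, there exists a probability distribution ℓ on {1, ..., n-1} such that if each vertex of the directed n-cycle independently gets one shortcut whose length is distributed according to ℓ, then the resulting hitting probabilities h of greedy routing to vertex 0 satisfy ℓ(x) = h(x) / (Σ_{ξ=1}^{n-1} h(ξ)) for all x (i.e., a balanced distribution exists). -/

import Mathlib

open Finset

/-- The backwards equations for the hitting probabilities of greedy routing to `0`
on the directed `n`-cycle with independent shortcuts of length distribution `ℓ`. -/
def BackEq (n : ℕ) (ℓ h : ℕ → ℝ) : Prop :=
  h (n - 1) = 1 / ((n : ℝ) - 1) ∧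
    ∀ x, 1 ≤ x → x ≤ n - 2 →
      h x = (∑ ξ ∈ Ioc x (n - 1), h ξ * ℓ (ξ - x))
        + h (x + 1) * (∑ ξ ∈ Ioc (x + 1) (n - 1), ℓ ξ) + 1 / ((n : ℝ) - 1)

/-- Dominance of a finite set of vertices with respect to a family of orders (Scarf). -/
def ScarfDom {V I α : Type*} [LinearOrder α] (r : I → V → α) (ρ : Finset V) : Prop :=
  ∀ y, ∃ i, ∀ x ∈ ρ, r i y ≤ r i x

/-- `x` is the `a`-largest element above all the minima `m j`, `j ≠ a`. -/
def ScarfMx {V I α : Type*} [LinearOrder α] (r : I → V → α) (m : I → V) (a : I) (x : V) : Prop :=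
  (∀ j, j ≠ a → r j (m j) < r j x) ∧
    ∀ y, (∀ j, j ≠ a → r j (m j) < r j y) → r a y ≤ r a x

theorem scarf_mx_imp {V I α : Type*} [LinearOrder α] [DecidableEq V]
    (r : I → V → α) (δ : Finset V) (hD : ScarfDom r δ)
    (m : I → V) (hmin : ∀ i, ∀ x ∈ δ, r i (m i) ≤ r i x) (hm : ∀ i, m i ∈ δ)
    (hsurj : ∀ x ∈ δ, ∃ i, m i = x)
    (a b : I) (hab : a ≠ b) (hmab : m a = m b) (x : V) (hx : ScarfMx r m a x) :
    x ∉ δ ∧ ScarfDom r (insert x δ) := by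
  constructor
  · intro hxδ
    obtain ⟨k, rfl⟩ := hsurj x hxδ
    by_cases hk : k = a
    · subst hk
      have := hx.1 b hab.symm
      rw [hmab] at this
      exact lt_irrefl _ this
    · exact lt_irrefl _ (hx.1 k hk)
  · intro y
    by_cases hy : ∀ j, j ≠ a → r j (m j) < r j y
    · refine ⟨a, ?_⟩
      obtain ⟨k, hk⟩ := hD y
      have hka : k = a := by
        by_contra hne
        exact absurd (hk _ (hm k)) (not_le.2 (hy k hne))
      subst hka
      intro z hz
      rcases Finset.mem_insert.1 hz with rfl | hz
      · exact hx.2 y hy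
      · exact hk z hz
    · push Not at hy
      obtain ⟨j, hj, hle⟩ := hy
      refine ⟨j, fun z hz => ?_⟩
      rcases Finset.mem_insert.1 hz with rfl | hz
      · exact hle.trans (hx.1 j hj).le
      · exact hle.trans (hmin j z hz)

theorem scarf_imp_mx {V I α : Type*} [LinearOrder α] [DecidableEq V]
    (r : I → V → α) (hr : ∀ i, Function.Injective (r i)) (δ : Finset V)
    (m : I → V) (hmin : ∀ i, ∀ x ∈ δ, r i (m i) ≤ r i x) (hm : ∀ i, m i ∈ δ)
    (a b : I) (hab : a ≠ b) (hmab : m a = m b)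
    (ha : ∀ i j, i ≠ a → j ≠ a → m i = m j → i = j)
    (hb : ∀ i j, i ≠ b → j ≠ b → m i = m j → i = j)
    (x : V) (hx : x ∉ δ) (hD : ScarfDom r (insert x δ)) :
    ScarfMx r m a x ∨ ScarfMx r m b x := by
  obtain ⟨i, hi⟩ := hD x
  have hix : ∀ z ∈ δ, r i x ≤ r i z := fun z hz => hi z (Finset.mem_insert_of_mem hz)
  have key : ∀ z ∈ δ, ∃ k, k ≠ i ∧ m k = z ∧ r k z < r k x := by
    intro z hz
    obtain ⟨k, hk⟩ := hD z
    have h1 : r k z ≤ r k x := hk x (Finset.mem_insert_self _ _)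
    have hne : z ≠ x := fun h => hx (h ▸ hz)
    have h2 : r k z < r k x := lt_of_le_of_ne h1 (fun h => hne (hr k h))
    refine ⟨k, ?_, ?_, h2⟩
    · rintro rfl
      exact absurd (hix z hz) (not_le.2 h2)
    · apply hr k
      exact le_antisymm (hmin k z hz) (hk _ (Finset.mem_insert_of_mem (hm k)))
  have gen : ∀ a, i = a → (∀ i j, i ≠ a → j ≠ a → m i = m j → i = j) → ScarfMx r m a x := by
    rintro a rfl ha
    refine ⟨fun j hj => ?_, fun y hy => ?_⟩
    · obtain ⟨k, hki, hkm, hlt⟩ := key (m j) (hm j)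
      have := ha k j hki hj hkm
      subst this
      exact hlt
    · obtain ⟨k, hk⟩ := hD y
      have hka : k = i := by
        by_contra hne
        exact absurd (hk _ (Finset.mem_insert_of_mem (hm k))) (not_le.2 (hy k hne))
      subst hka
      exact hk x (Finset.mem_insert_self _ _)
  by_cases hia : i = a
  · exact Or.inl (gen a hia ha)
  by_cases hib : i = b
  · exact Or.inr (gen b hib hb)
  exfalso
  obtain ⟨k, hki, hkm, -⟩ := key (m i) (hm i)
  by_cases hka : k = a
  · subst hka
    exact hib (ha i b hia hab.symm (hkm.symm.trans hmab))
  · exact hki (ha k i hka hia hkm)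

theorem scarf_door {V I α : Type*} [LinearOrder α] [DecidableEq V] [Fintype I] [DecidableEq I]
    (r : I → V → α) (hr : ∀ i, Function.Injective (r i)) (δ : Finset V)
    (hne : δ.Nonempty) (hcard : δ.card + 1 = Fintype.card I) (hD : ScarfDom r δ) :
    ∃ (m : I → V) (a b : I), a ≠ b ∧ m a = m b ∧ (∀ i, m i ∈ δ) ∧
      (∀ i, ∀ x ∈ δ, r i (m i) ≤ r i x) ∧
      (∀ x, (x ∉ δ ∧ ScarfDom r (insert x δ)) ↔ (ScarfMx r m a x ∨ ScarfMx r m b x)) := by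
  have hex : ∀ i, ∃ v ∈ δ, ∀ x ∈ δ, r i v ≤ r i x := fun i => Finset.exists_min_image δ (r i) hne
  choose m hm hmin using hex
  have hsurj : ∀ x ∈ δ, ∃ i, m i = x := by
    intro x hx
    obtain ⟨i, hi⟩ := hD x
    exact ⟨i, hr i (le_antisymm (hmin i x hx) (hi _ (hm i)))⟩
  obtain ⟨a, -, b, -, hab, hmab⟩ := Finset.exists_ne_map_eq_of_card_lt_of_maps_to
    (s := (Finset.univ : Finset I)) (t := δ) (f := m)
    (by rw [Finset.card_univ]; omega) (fun i _ => hm i)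
  have inj : ∀ a b, a ≠ b → m a = m b → ∀ i j, i ≠ a → j ≠ a → m i = m j → i = j := by
    intro a b hab hmab
    have himg : (Finset.univ.erase a).image m = δ := by
      ext x
      simp only [Finset.mem_image, Finset.mem_erase, Finset.mem_univ, and_true]
      constructor
      · rintro ⟨i, -, rfl⟩
        exact hm i
      · intro hx
        obtain ⟨i, rfl⟩ := hsurj x hx
        by_cases hia : i = a
        · subst hia
          exact ⟨b, hab.symm, hmab.symm⟩
        · exact ⟨i, hia, rfl⟩
    have hc : ((Finset.univ.erase a).image m).card = (Finset.univ.erase a).card := by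
      rw [himg, Finset.card_erase_of_mem (Finset.mem_univ _), Finset.card_univ]
      omega
    have := Finset.card_image_iff.1 hc
    intro i j hi hj h
    exact this (by simpa using hi) (by simpa using hj) h
  refine ⟨m, a, b, hab, hmab, hm, hmin, fun x => ⟨fun h => ?_, fun h => ?_⟩⟩
  · exact scarf_imp_mx r hr δ m hmin hm a b hab hmab (inj a b hab hmab)
      (inj b a hab.symm hmab.symm) x h.1 h.2
  · rcases h with h | h
    · exact scarf_mx_imp r δ hD m hmin hm hsurj a b hab hmab x h
    · exact scarf_mx_imp r δ hD m hmin hm hsurj b a hab.symm hmab.symm x h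

theorem scarf_mx_exists {V I α : Type*} [LinearOrder α] [Fintype V]
    (r : I → V → α) (m : I → V) (a : I) (y : V) (hy : ∀ j, j ≠ a → r j (m j) < r j y) :
    ∃ x, ScarfMx r m a x := by
  classical
  obtain ⟨x, hx, hmax⟩ := Finset.exists_max_image
    (Finset.univ.filter (fun y => ∀ j, j ≠ a → r j (m j) < r j y)) (r a) ⟨y, by simpa using hy⟩
  exact ⟨x, by simpa using hx, fun y hy => hmax y (by simpa using hy)⟩

theorem scarf_mx_unique {V I α : Type*} [LinearOrder α]
    (r : I → V → α) (hr : ∀ i, Function.Injective (r i)) (m : I → V) (a : I) (x y : V)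
    (hx : ScarfMx r m a x) (hy : ScarfMx r m a y) : x = y :=
  hr a (le_antisymm (hy.2 x hx.1) (hx.2 y hy.1))

open Classical in
/-- Doors which are not on the outside lie in exactly two rooms. -/
theorem scarf_count_two {V I α : Type*} [LinearOrder α] [Fintype V] [Fintype I]
    (r : I → V → α) (hr : ∀ i, Function.Injective (r i))
    (s : I → V) (hs1 : ∀ i v, v ≠ s i → r i (s i) < r i v)
    (hs2 : ∀ i j v, j ≠ i → (∀ k, v ≠ s k) → r i v < r i (s j))
    (δ : Finset V) (hcard : δ.card + 1 = Fintype.card I) (hD : ScarfDom r δ)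
    (t : V) (ht : t ∈ δ) (hts : ∀ k, t ≠ s k) :
    (Finset.univ.filter (fun x => x ∉ δ ∧ ScarfDom r (insert x δ))).card = 2 := by
  obtain ⟨m, a, b, hab, hmab, hm, hmin, hiff⟩ := scarf_door r hr δ ⟨t, ht⟩ hcard hD
  have ex : ∀ a b, a ≠ b → m a = m b → ∃ x, ScarfMx r m a x := by
    intro a b hab hmab
    apply scarf_mx_exists r m a (s a)
    intro j hj
    exact (hmin j t ht).trans_lt (hs2 j a t hj.symm hts)
  obtain ⟨xa, hxa⟩ := ex a b hab hmab
  obtain ⟨xb, hxb⟩ := ex b a hab.symm hmab.symm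
  have hne : xa ≠ xb := by
    rintro rfl
    obtain ⟨k, hk⟩ := hD xa
    have h := hk _ (hm k)
    by_cases hka : k = a
    · exact absurd h (not_le.2 (hxb.1 k (hka ▸ hab)))
    · exact absurd h (not_le.2 (hxa.1 k hka))
  rw [Finset.card_eq_two]
  refine ⟨xa, xb, hne, ?_⟩
  ext x
  simp only [Finset.mem_filter, Finset.mem_univ, true_and, Finset.mem_insert,
    Finset.mem_singleton]
  rw [hiff]
  constructor
  · rintro (h | h)
    · exact Or.inl (scarf_mx_unique r hr m a _ _ h hxa)
    · exact Or.inr (scarf_mx_unique r hr m b _ _ h hxb)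
  · rintro (rfl | rfl)
    · exact Or.inl hxa
    · exact Or.inr hxb

open Classical in
/-- The outside door lies in exactly one room. -/
theorem scarf_count_one {V I α : Type*} [LinearOrder α] [Fintype V] [Fintype I]
    (r : I → V → α) (hr : ∀ i, Function.Injective (r i))
    (s : I → V) (hsinj : Function.Injective s) (hs1 : ∀ i v, v ≠ s i → r i (s i) < r i v)
    (hs2 : ∀ i j v, j ≠ i → (∀ k, v ≠ s k) → r i v < r i (s j))
    (i0 : I) (hI : 2 ≤ Fintype.card I)
    (δ : Finset V) (hcard : δ.card + 1 = Fintype.card I) (hD : ScarfDom r δ)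
    (hδ : ∀ x, x ∈ δ ↔ ∃ j, j ≠ i0 ∧ s j = x) :
    (Finset.univ.filter (fun x => x ∉ δ ∧ ScarfDom r (insert x δ))).card = 1 := by
  obtain ⟨m, a, b, hab, hmab, hm, hmin, hiff⟩ := scarf_door r hr δ
    (Finset.card_pos.1 (by omega)) hcard hD
  have hms : ∀ j, j ≠ i0 → m j = s j := by
    intro j hj
    by_contra hne
    exact absurd (hmin j (s j) ((hδ _).2 ⟨j, hj, rfl⟩)) (not_le.2 (hs1 j _ hne))
  have main : ∀ b, b ≠ i0 → m i0 = m b →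
      (∀ x, (x ∉ δ ∧ ScarfDom r (insert x δ)) ↔ (ScarfMx r m i0 x ∨ ScarfMx r m b x)) →
      (Finset.univ.filter (fun x => x ∉ δ ∧ ScarfDom r (insert x δ))).card = 1 := by
    intro b hb hmb hiff
    obtain ⟨x0, hx0⟩ := scarf_mx_exists r m i0 (s i0) (by
      intro j hj
      rw [hms j hj]
      exact hs1 j _ (fun h => hj (hsinj h).symm))
    have hno : ∀ y, ¬ ScarfMx r m b y := by
      rintro y ⟨hy, -⟩
      have h0 := hy i0 hb.symm
      rw [hmb, hms b hb] at h0
      by_cases hys : ∀ k, y ≠ s k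
      · exact absurd h0 (not_lt.2 (hs2 i0 b y hb hys).le)
      · push Not at hys
        obtain ⟨k, rfl⟩ := hys
        by_cases hk0 : k = i0
        · subst hk0
          exact absurd h0 (not_lt.2 (hs1 k _ (fun h => hb (hsinj h))).le)
        by_cases hkb : k = b
        · subst hkb
          exact lt_irrefl _ h0
        · have := hy k hkb
          rw [hms k hk0] at this
          exact lt_irrefl _ this
    rw [Finset.card_eq_one]
    refine ⟨x0, ?_⟩
    ext x
    simp only [Finset.mem_filter, Finset.mem_univ, true_and, Finset.mem_singleton]
    rw [hiff]
    constructor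
    · rintro (h | h)
      · exact scarf_mx_unique r hr m i0 _ _ h hx0
      · exact absurd h (hno x)
    · rintro rfl
      exact Or.inl hx0
  by_cases ha0 : a = i0
  · subst ha0
    exact main b hab.symm hmab hiff
  by_cases hb0 : b = i0
  · subst hb0
    exact main a hab hmab.symm (fun x => (hiff x).trans or_comm)
  exfalso
  rw [hms a ha0, hms b hb0] at hmab
  exact hab (hsinj hmab)

open Classical in
theorem scarf_room_even {V I : Type*} [Fintype V] [Fintype I] (c : V → I) (i0 : I)
    (ρ : Finset V) (hcard : ρ.card = Fintype.card I) (hno : ¬ ∀ i, ∃ x ∈ ρ, c x = i) :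
    Even (ρ.filter (fun x => (ρ.erase x).image c = Finset.univ.erase i0)).card := by
  by_cases hex : ∃ x ∈ ρ, (ρ.erase x).image c = Finset.univ.erase i0
  · obtain ⟨x, hx, hxi⟩ := hex
    have hcx : c x ≠ i0 := by
      intro h
      apply hno
      intro i
      by_cases hi : i = i0
      · exact ⟨x, hx, h.trans hi.symm⟩
      · have : i ∈ (ρ.erase x).image c := by rw [hxi]; simpa using hi
        obtain ⟨z, hz, hzi⟩ := Finset.mem_image.1 this
        exact ⟨z, Finset.mem_of_mem_erase hz, hzi⟩
    have hinj : Set.InjOn c (ρ.erase x : Finset V) := by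
      apply Finset.card_image_iff.1
      rw [hxi, Finset.card_erase_of_mem (Finset.mem_univ _), Finset.card_erase_of_mem hx, hcard,
        Finset.card_univ]
    have : c x ∈ (ρ.erase x).image c := by rw [hxi]; simpa using hcx
    obtain ⟨x', hx', hcx'⟩ := Finset.mem_image.1 this
    have hx'ρ := Finset.mem_of_mem_erase hx'
    have hne : x' ≠ x := Finset.ne_of_mem_erase hx'
    have : ρ.filter (fun x => (ρ.erase x).image c = Finset.univ.erase i0) = {x, x'} := by
      ext z
      simp only [Finset.mem_filter, Finset.mem_insert, Finset.mem_singleton]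
      constructor
      · rintro ⟨hz, hzi⟩
        by_contra hcon
        push Not at hcon
        have : c z ∈ (ρ.erase z).image c := by
          rw [hzi, ← hxi]
          exact Finset.mem_image_of_mem _ (Finset.mem_erase.2 ⟨hcon.1, hz⟩)
        obtain ⟨w, hw, hwz⟩ := Finset.mem_image.1 this
        have hwρ := Finset.mem_of_mem_erase hw
        have hwz' := Finset.ne_of_mem_erase hw
        by_cases hwx : w = x
        · subst hwx
          exact hcon.2 (hinj (Finset.mem_coe.2 (Finset.mem_erase.2 ⟨hcon.1, hz⟩))
            (Finset.mem_coe.2 hx') (hwz.symm.trans hcx'.symm))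
        · exact hwz' (hinj (Finset.mem_coe.2 (Finset.mem_erase.2 ⟨hwx, hwρ⟩))
            (Finset.mem_coe.2 (Finset.mem_erase.2 ⟨hcon.1, hz⟩)) hwz)
      · rintro (rfl | rfl)
        · exact ⟨hx, hxi⟩
        · refine ⟨hx'ρ, ?_⟩
          rw [← hxi]
          ext i
          simp only [Finset.mem_image, Finset.mem_erase]
          constructor
          · rintro ⟨w, ⟨hw1, hw2⟩, rfl⟩
            by_cases hwx : w = x
            · exact ⟨z, ⟨hne, hx'ρ⟩, by rw [hwx, hcx']⟩
            · exact ⟨w, ⟨hwx, hw2⟩, rfl⟩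
          · rintro ⟨w, ⟨hw1, hw2⟩, rfl⟩
            by_cases hwx : w = z
            · exact ⟨x, ⟨hne.symm, hx⟩, by rw [hwx, hcx']⟩
            · exact ⟨w, ⟨hwx, hw2⟩, rfl⟩
    rw [this, Finset.card_pair hne.symm]
    exact even_two
  · push Not at hex
    rw [Finset.filter_eq_empty_iff.2 (fun {x} hx => hex x hx)]
    simp

/-- Scarf's combinatorial lemma. -/
theorem scarf_lemma {V I α : Type*} [LinearOrder α] [Fintype V] [Fintype I]
    (r : I → V → α) (hr : ∀ i, Function.Injective (r i))
    (s : I → V) (hs1 : ∀ i v, v ≠ s i → r i (s i) < r i v)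
    (hs2 : ∀ i j v, j ≠ i → (∀ k, v ≠ s k) → r i v < r i (s j))
    (c : V → I) (hc : ∀ i, c (s i) = i) (v0 : V) (hv0 : ∀ k, v0 ≠ s k) (i0 : I) :
    ∃ ρ : Finset V, ρ.card = Fintype.card I ∧ ScarfDom r ρ ∧ ∀ i, ∃ x ∈ ρ, c x = i := by
  classical
  have hsinj : Function.Injective s := fun i j h => by rw [← hc i, ← hc j, h]
  by_cases hI : Fintype.card I < 2
  · have hsub : Subsingleton I := Fintype.card_le_one_iff_subsingleton.1 (by omega)
    have hpos : 0 < Fintype.card I := Fintype.card_pos_iff.2 ⟨i0⟩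
    obtain ⟨x, -, hx⟩ := Finset.exists_max_image Finset.univ (r i0) ⟨v0, Finset.mem_univ _⟩
    refine ⟨{x}, ?_, ?_, ?_⟩
    · simp; omega
    · intro y
      exact ⟨i0, by simpa using hx y (Finset.mem_univ _)⟩
    · intro i
      exact ⟨x, by simp, Subsingleton.elim _ _⟩
  push Not at hI
  by_contra hcon
  push Not at hcon
  let rooms : Finset (Finset V) :=
    Finset.univ.filter (fun ρ => ρ.card = Fintype.card I ∧ ScarfDom r ρ)
  let doors : Finset (Finset V) :=
    Finset.univ.filter (fun δ => δ.card + 1 = Fintype.card I ∧ ScarfDom r δ ∧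
      δ.image c = Finset.univ.erase i0)
  have hdc := Finset.sum_card_bipartiteAbove_eq_sum_card_bipartiteBelow
    (s := doors) (t := rooms) (fun δ ρ => δ ⊆ ρ)
  have hrooms : Even (∑ ρ ∈ rooms, (Finset.bipartiteBelow (fun δ ρ => δ ⊆ ρ) doors ρ).card) := by
    apply Finset.even_sum
    intro ρ hρ
    simp only [rooms, Finset.mem_filter, Finset.mem_univ, true_and] at hρ
    have hev := scarf_room_even c i0 ρ hρ.1 (fun h => by
      obtain ⟨i, hi⟩ := hcon ρ hρ.1 hρ.2
      obtain ⟨x, hx, hxi⟩ := h i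
      exact hi x hx hxi)
    have : Finset.bipartiteBelow (fun δ ρ => δ ⊆ ρ) doors ρ =
        (ρ.filter (fun x => (ρ.erase x).image c = Finset.univ.erase i0)).image
          (fun x => ρ.erase x) := by
      ext δ
      simp only [Finset.mem_bipartiteBelow, doors, Finset.mem_filter, Finset.mem_univ, true_and,
        Finset.mem_image]
      constructor
      · rintro ⟨⟨h1, h2, h3⟩, h4⟩
        obtain ⟨x, hx⟩ : ∃ x, ρ \ δ = {x} := by
          apply Finset.card_eq_one.1
          rw [Finset.card_sdiff_of_subset h4]
          omega
        have hxm : x ∈ ρ ∧ x ∉ δ := Finset.mem_sdiff.1 (by rw [hx]; simp)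
        have he : ρ.erase x = δ := by
          rw [← Finset.sdiff_singleton_eq_erase, ← hx, Finset.sdiff_sdiff_eq_self h4]
        exact ⟨x, ⟨hxm.1, by rw [he, h3]⟩, he⟩
      · rintro ⟨x, ⟨hx, hxi⟩, rfl⟩
        refine ⟨⟨?_, ?_, hxi⟩, Finset.erase_subset _ _⟩
        · rw [Finset.card_erase_of_mem hx]
          omega
        · intro y
          obtain ⟨i, hi⟩ := hρ.2 y
          exact ⟨i, fun z hz => hi z (Finset.mem_of_mem_erase hz)⟩
    rw [this, Finset.card_image_of_injOn]
    · exact hev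
    · intro x hx y hy hxy
      have hx' : x ∈ ρ := (Finset.mem_filter.1 hx).1
      by_contra hne
      have : x ∈ ρ.erase y := Finset.mem_erase.2 ⟨hne, hx'⟩
      have h2 : x ∈ ρ.erase x := by
        have hxy' : ρ.erase x = ρ.erase y := hxy
        rw [hxy']; exact this
      simp at h2
  have hup : ∀ δ ∈ doors, (Finset.bipartiteAbove (fun δ ρ => δ ⊆ ρ) rooms δ).card =
      (Finset.univ.filter (fun x => x ∉ δ ∧ ScarfDom r (insert x δ))).card := by
    intro δ hδ
    simp only [doors, Finset.mem_filter, Finset.mem_univ, true_and] at hδ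
    have : Finset.bipartiteAbove (fun δ ρ => δ ⊆ ρ) rooms δ =
        (Finset.univ.filter (fun x => x ∉ δ ∧ ScarfDom r (insert x δ))).image
          (fun x => insert x δ) := by
      ext ρ
      simp only [Finset.mem_bipartiteAbove, rooms, Finset.mem_filter, Finset.mem_univ, true_and,
        Finset.mem_image]
      constructor
      · rintro ⟨⟨h1, h2⟩, h4⟩
        obtain ⟨x, hx⟩ : ∃ x, ρ \ δ = {x} := by
          apply Finset.card_eq_one.1
          rw [Finset.card_sdiff_of_subset h4]
          omega
        have hxm : x ∈ ρ ∧ x ∉ δ := Finset.mem_sdiff.1 (by rw [hx]; simp)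
        have he : insert x δ = ρ := by
          rw [Finset.insert_eq, ← hx, Finset.sdiff_union_of_subset h4]
        exact ⟨x, ⟨hxm.2, by rw [he]; exact h2⟩, he⟩
      · rintro ⟨x, ⟨hx, hxi⟩, rfl⟩
        refine ⟨⟨?_, hxi⟩, Finset.subset_insert _ _⟩
        rw [Finset.card_insert_of_notMem hx]
        omega
    rw [this, Finset.card_image_of_injOn]
    intro x hx y hy hxy
    have hx' : x ∉ δ := (Finset.mem_filter.1 hx).2.1
    have hxy' : insert x δ = insert y δ := hxy
    have : x ∈ insert y δ := by rw [← hxy']; exact Finset.mem_insert_self _ _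
    rcases Finset.mem_insert.1 this with h | h
    · exact h
    · exact absurd h hx'
  let δ0 : Finset V := (Finset.univ.erase i0).image s
  have hδ0mem : ∀ x, x ∈ δ0 ↔ ∃ j, j ≠ i0 ∧ s j = x := by
    intro x
    simp [δ0]
  have hδ0 : δ0 ∈ doors := by
    simp only [doors, Finset.mem_filter, Finset.mem_univ, true_and]
    refine ⟨?_, ?_, ?_⟩
    · rw [Finset.card_image_of_injective _ hsinj, Finset.card_erase_of_mem (Finset.mem_univ _),
        Finset.card_univ]
      omega
    · intro y
      by_cases hy : ∀ k, y ≠ s k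
      · refine ⟨i0, fun x hx => ?_⟩
        obtain ⟨j, hj, rfl⟩ := (hδ0mem x).1 hx
        exact (hs2 i0 j y hj hy).le
      · push Not at hy
        obtain ⟨k, rfl⟩ := hy
        refine ⟨k, fun x hx => ?_⟩
        by_cases hxk : x = s k
        · rw [hxk]
        · exact (hs1 k x hxk).le
    · ext i
      simp [δ0, Finset.image_image, Function.comp_def, hc]
  have hdoors : Odd (∑ δ ∈ doors, (Finset.bipartiteAbove (fun δ ρ => δ ⊆ ρ) rooms δ).card) := by
    rw [← Finset.add_sum_erase _ _ hδ0]
    apply Odd.add_even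
    · rw [hup _ hδ0]
      have h := hδ0
      simp only [doors, Finset.mem_filter, Finset.mem_univ, true_and] at h
      rw [scarf_count_one r hr s hsinj hs1 hs2 i0 hI δ0 h.1 h.2.1 hδ0mem]
      exact odd_one
    · apply Finset.even_sum
      intro δ hδ
      have hδ1 := Finset.mem_of_mem_erase hδ
      have hδne := Finset.ne_of_mem_erase hδ
      rw [hup _ hδ1]
      have h := hδ1
      simp only [doors, Finset.mem_filter, Finset.mem_univ, true_and] at h
      have : ∃ t ∈ δ, ∀ k, t ≠ s k := by
        by_contra hall
        push Not at hall
        apply hδne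
        apply Finset.eq_of_subset_of_card_le
        · intro x hx
          obtain ⟨k, rfl⟩ := hall x hx
          refine (hδ0mem _).2 ⟨k, ?_, rfl⟩
          have : c (s k) ∈ δ.image c := Finset.mem_image_of_mem _ hx
          rw [h.2.2, hc] at this
          exact Finset.ne_of_mem_erase this
        · have h0 := hδ0
          simp only [doors, Finset.mem_filter, Finset.mem_univ, true_and] at h0
          omega
      obtain ⟨t, ht, hts⟩ := this
      rw [scarf_count_two r hr s hs1 hs2 δ h.1 h.2.1 t ht hts]
      exact even_two
  rw [hdc] at hdoors
  exact (Nat.not_even_iff_odd.2 hdoors) hrooms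

/-- The orders on grid points and slack vertices. -/
noncomputable def gridRank {I : Type*} [Fintype I] [DecidableEq I] (N : ℕ) (i : I) :
    ((Finset.piAntidiag (Finset.univ : Finset I) N) ⊕ I) → ℕ ×ₗ ℕ
  | Sum.inl t => toLex (t.1 i + 1, (Fintype.equivFin _ t : ℕ))
  | Sum.inr j => if j = i then toLex (0, 0) else toLex (N + 2, (Fintype.equivFin _ j : ℕ))

theorem brouwer_grid {I : Type*} [Fintype I] (i0 : I) (N : ℕ) (lab : (I → ℕ) → I) :
    ∃ p : I → ℕ, ∑ i, p i = N ∧ ∀ i, p i ≤ Fintype.card I ∨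
      ∃ q : I → ℕ, ∑ i, q i = N ∧ lab q = i ∧
        ∀ j, q j ≤ p j + Fintype.card I ∧ p j ≤ q j + Fintype.card I := by
  classical
  let T := (Finset.piAntidiag (Finset.univ : Finset I) N)
  have hT : ∀ t : T, ∑ i, t.1 i = N := fun t => by
    have := t.2
    simp only [T, Finset.mem_piAntidiag] at this
    exact this.1
  have hTle : ∀ (t : T) i, t.1 i ≤ N := fun t i => by
    rw [← hT t]
    exact Finset.single_le_sum (f := t.1) (fun _ _ => Nat.zero_le _) (Finset.mem_univ i)
  have mkT : ∀ k : I → ℕ, ∑ i, k i = N → k ∈ Finset.piAntidiag (Finset.univ : Finset I) N := by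
    intro k hk
    simp [Finset.mem_piAntidiag, hk]
  let t0 : T := ⟨fun i => if i = i0 then N else 0, mkT _ (by simp)⟩
  have hrl : ∀ i (t : T), gridRank N i (Sum.inl t) =
    toLex (t.1 i + 1, (Fintype.equivFin _ t : ℕ)) := fun _ _ => rfl
  have hrr : ∀ i j : I, gridRank N i (Sum.inr j) =
    if j = i then toLex (0, 0) else toLex (N + 2, (Fintype.equivFin _ j : ℕ)) := fun _ _ => rfl
  obtain ⟨ρ, hcard, hD, hcol⟩ := scarf_lemma (V := T ⊕ I) (gridRank N)
    (by
      intro i x y hxy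
      rcases x with x | x <;> rcases y with y | y
      · rw [hrl, hrl] at hxy
        have := (Prod.ext_iff.1 (toLex.injective hxy)).2
        simp only at this
        rw [(Fintype.equivFin _).injective (Fin.ext this)]
      · rw [hrl, hrr] at hxy
        have hx := hTle x i
        split_ifs at hxy
        · have := (Prod.ext_iff.1 (toLex.injective hxy)).1
          simp at this
        · have := (Prod.ext_iff.1 (toLex.injective hxy)).1
          simp at this
          omega
      · rw [hrl, hrr] at hxy
        have hx := hTle y i
        split_ifs at hxy
        · have := (Prod.ext_iff.1 (toLex.injective hxy)).1
          simp at this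
        · have := (Prod.ext_iff.1 (toLex.injective hxy)).1
          simp at this
          omega
      · rw [hrr, hrr] at hxy
        split_ifs at hxy with h1 h2 h2
        · rw [h1, h2]
        · have := (Prod.ext_iff.1 (toLex.injective hxy)).1
          simp at this
        · have := (Prod.ext_iff.1 (toLex.injective hxy)).1
          simp at this
        · have := (Prod.ext_iff.1 (toLex.injective hxy)).2
          simp only at this
          rw [(Fintype.equivFin _).injective (Fin.ext this)])
    Sum.inr
    (by
      intro i v hv
      rw [hrr, if_pos rfl]
      rcases v with v | v
      · rw [hrl, Prod.Lex.toLex_lt_toLex]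
        left
        simp
      · have : v ≠ i := fun h => hv (by rw [h])
        rw [hrr, if_neg this, Prod.Lex.toLex_lt_toLex]
        left
        simp)
    (by
      intro i j v hj hv
      rcases v with v | v
      · rw [hrl, hrr, if_neg hj, Prod.Lex.toLex_lt_toLex]
        left
        have := hTle v i
        simp only
        omega
      · exact absurd rfl (hv v))
    (Sum.elim (fun t => lab t.1) id) (fun i => rfl) (Sum.inl t0) (by simp) i0
  have hslack : ∀ (y : T) i, (∀ x ∈ ρ, gridRank N i (Sum.inl y) ≤ gridRank N i x) →
      Sum.inr i ∉ ρ := by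
    intro y i h hi
    have := h _ hi
    rw [hrl, hrr, if_pos rfl, Prod.Lex.toLex_le_toLex] at this
    simp at this
  obtain ⟨iC, hiC⟩ := hD (Sum.inl t0)
  have hiC := hslack _ _ hiC
  have hσ : ∃ p : T, Sum.inl p ∈ ρ := by
    by_contra hno
    push Not at hno
    have hsub : ρ ⊆ (Finset.univ.erase iC).image Sum.inr := by
      intro x hx
      rcases x with x | x
      · exact absurd hx (hno x)
      · refine Finset.mem_image_of_mem _ (Finset.mem_erase.2 ⟨?_, Finset.mem_univ _⟩)
        rintro rfl
        exact hiC hx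
    have h1 := (Finset.card_le_card hsub).trans Finset.card_image_le
    rw [Finset.card_erase_of_mem (Finset.mem_univ _), Finset.card_univ, hcard] at h1
    have : 0 < Fintype.card I := Fintype.card_pos_iff.2 ⟨i0⟩
    omega
  obtain ⟨p, hp⟩ := hσ
  have hμ : ∀ i, ∃ μ : ℕ, (∀ t : T, Sum.inl t ∈ ρ → μ ≤ t.1 i) ∧
      (Sum.inr i ∈ ρ → μ = 0) ∧ (Sum.inr i ∉ ρ → ∃ t : T, Sum.inl t ∈ ρ ∧ μ = t.1 i) := by
    intro i
    by_cases hi : Sum.inr i ∈ ρ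
    · exact ⟨0, fun _ _ => Nat.zero_le _, fun _ => rfl, fun h => absurd hi h⟩
    · obtain ⟨t, ht, hmin⟩ := Finset.exists_min_image
        (Finset.univ.filter (fun t : T => Sum.inl t ∈ ρ)) (fun t => t.1 i) ⟨p, by simpa using hp⟩
      refine ⟨t.1 i, fun t' ht' => hmin t' (by simpa using ht'), fun h => absurd h hi,
        fun _ => ⟨t, by simpa using ht, rfl⟩⟩
  choose μ hμ1 hμ2 hμ3 using hμ
  have hsum : N < ∑ i, μ i + Fintype.card I := by
    by_contra hle
    push Not at hle
    let y : I → ℕ := fun i => μ i + 1 +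
      (if i = iC then N - (∑ i, μ i + Fintype.card I) else 0)
    have hy : ∑ i, y i = N := by
      simp only [y, Finset.sum_add_distrib, Finset.sum_ite_eq', Finset.mem_univ, if_true,
        Finset.sum_const, Finset.card_univ, smul_eq_mul, mul_one]
      omega
    obtain ⟨i, hi⟩ := hD (Sum.inl ⟨y, mkT y hy⟩)
    obtain ⟨t, ht, hti⟩ := hμ3 i (hslack _ _ hi)
    have h := hi _ ht
    rw [hrl, hrl, Prod.Lex.toLex_le_toLex] at h
    have h2 : μ i + 1 ≤ y i := Nat.le_add_right _ _
    simp only at h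
    omega
  have hclose : ∀ t : T, Sum.inl t ∈ ρ → ∀ j, t.1 j ≤ μ j + Fintype.card I := by
    intro t ht j
    have h1 : ∑ i, (t.1 i - μ i) + ∑ i, μ i = N := by
      rw [← Finset.sum_add_distrib, ← hT t]
      exact Finset.sum_congr rfl (fun i _ => Nat.sub_add_cancel (hμ1 i t ht))
    have h2 : t.1 j - μ j ≤ ∑ i, (t.1 i - μ i) :=
      Finset.single_le_sum (f := fun i => t.1 i - μ i) (fun _ _ => Nat.zero_le _)
        (Finset.mem_univ j)
    omega
  refine ⟨p.1, hT p, fun i => ?_⟩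
  obtain ⟨x, hx, hxi⟩ := hcol i
  rcases x with q | j
  · right
    refine ⟨q.1, hT q, hxi, fun j => ⟨?_, ?_⟩⟩
    · have := hclose q hx j
      have := hμ1 j p hp
      omega
    · have := hclose p hp j
      have := hμ1 j q hx
      omega
  · left
    have hj : j = i := hxi
    subst hj
    have := hclose p hp j
    rw [hμ2 j hx] at this
    omega

/-- Brouwer's fixed point theorem on the standard simplex. -/
theorem brouwer_simplex {I : Type*} [Fintype I] [Nonempty I] (f : (I → ℝ) → (I → ℝ))
    (hf : Continuous f) (hmaps : ∀ x ∈ stdSimplex ℝ I, f x ∈ stdSimplex ℝ I) :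
    ∃ x ∈ stdSimplex ℝ I, f x = x := by
  classical
  obtain ⟨i0⟩ := ‹Nonempty I›
  let sc : ℕ → (I → ℕ) → (I → ℝ) := fun N k i => (k i : ℝ) / ((N : ℝ) + 1)
  have hpos : ∀ N : ℕ, (0 : ℝ) < (N : ℝ) + 1 := fun N => by positivity
  have hsc : ∀ N k, ∑ i, k i = N + 1 → sc N k ∈ stdSimplex ℝ I := by
    intro N k hk
    refine ⟨fun i => div_nonneg (Nat.cast_nonneg _) (hpos N).le, ?_⟩
    simp only [sc]
    rw [← Finset.sum_div, ← Nat.cast_sum, hk]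
    push_cast
    exact div_self (hpos N).ne'
  have hlab : ∀ (N : ℕ) (k : I → ℕ), ∃ i, ∑ i, k i = N + 1 → sc N k i ≤ f (sc N k) i := by
    intro N k
    by_cases hk : ∑ i, k i = N + 1
    · have h1 := hsc N k hk
      have h2 := hmaps _ h1
      obtain ⟨i, -, hi⟩ := Finset.exists_le_of_sum_le (s := (Finset.univ : Finset I))
        (f := sc N k) (g := f (sc N k)) ⟨i0, Finset.mem_univ _⟩ (by rw [h1.2, h2.2])
      exact ⟨i, fun _ => hi⟩
    · exact ⟨i0, fun h => absurd h hk⟩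
  choose lab hlab using hlab
  have hgrid := fun N : ℕ => brouwer_grid i0 (N + 1) (lab N)
  choose p hp1 hp2 using hgrid
  let d : ℝ := Fintype.card I
  have hq : ∀ (N : ℕ) (i : I), ∃ q : I → ℝ, (∀ j, |q j - sc N (p N) j| ≤ d / ((N : ℝ) + 1)) ∧
      q i - d / ((N : ℝ) + 1) ≤ f q i := by
    intro N i
    have hd : 0 ≤ d / ((N : ℝ) + 1) := div_nonneg (Nat.cast_nonneg _) (hpos N).le
    rcases hp2 N i with h | ⟨q, hq1, hq2, hq3⟩
    · refine ⟨sc N (p N), fun j => by simpa using hd, ?_⟩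
      have h1 : 0 ≤ f (sc N (p N)) i := (hmaps _ (hsc N _ (hp1 N))).1 i
      have h2 : sc N (p N) i ≤ d / ((N : ℝ) + 1) := by
        simp only [sc]
        have : (p N i : ℝ) ≤ d := by simp only [d]; exact_mod_cast h
        exact div_le_div_of_nonneg_right this (hpos N).le
      linarith
    · refine ⟨sc N q, fun j => ?_, ?_⟩
      · simp only [sc]
        rw [← sub_div, abs_div, abs_of_pos (hpos N)]
        apply div_le_div_of_nonneg_right _ (hpos N).le
        have h1 : (q j : ℝ) ≤ p N j + d := by simp only [d]; exact_mod_cast (hq3 j).1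
        have h2 : (p N j : ℝ) ≤ q j + d := by simp only [d]; exact_mod_cast (hq3 j).2
        rw [abs_le]
        constructor <;> linarith
      · have := hlab N q hq1
        rw [hq2] at this
        linarith
  choose q hq1 hq2 using hq
  obtain ⟨x, hx, φ, hφ, hlim⟩ := (isCompact_stdSimplex ℝ I).tendsto_subseq
    (x := fun N => sc N (p N)) (fun N => hsc N _ (hp1 N))
  have herr : Filter.Tendsto (fun N : ℕ => d / ((φ N : ℝ) + 1)) Filter.atTop (nhds 0) := by
    have h1 : Filter.Tendsto (fun N : ℕ => d / ((N : ℝ) + 1)) Filter.atTop (nhds 0) := by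
      have := (tendsto_one_div_add_atTop_nhds_zero_nat (𝕜 := ℝ)).const_mul d
      simpa [div_eq_mul_inv] using this
    exact h1.comp hφ.tendsto_atTop
  have hqlim : ∀ i, Filter.Tendsto (fun N => q (φ N) i) Filter.atTop (nhds x) := by
    intro i
    rw [tendsto_pi_nhds] at hlim ⊢
    intro j
    have h0 : Filter.Tendsto (fun N => q (φ N) i j - sc (φ N) (p (φ N)) j) Filter.atTop
        (nhds 0) :=
      squeeze_zero_norm (fun N => by rw [Real.norm_eq_abs]; exact hq1 (φ N) i j) herr
    have := h0.add (hlim j)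
    simpa using this
  have hle : ∀ i, x i ≤ f x i := by
    intro i
    have hA : Filter.Tendsto (fun N => q (φ N) i i - d / ((φ N : ℝ) + 1)) Filter.atTop
        (nhds (x i - 0)) :=
      ((tendsto_pi_nhds.1 (hqlim i)) i).sub herr
    have hB : Filter.Tendsto (fun N => f (q (φ N) i) i) Filter.atTop (nhds (f x i)) :=
      ((continuous_apply i).comp hf).continuousAt.tendsto.comp (hqlim i)
    have := le_of_tendsto_of_tendsto' hA hB (fun N => hq2 (φ N) i)
    simpa using this
  refine ⟨x, hx, ?_⟩
  have hs : ∑ i, x i = ∑ i, f x i := by rw [hx.2, (hmaps x hx).2]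
  have := (Finset.sum_eq_sum_iff_of_le (fun i _ => hle i)).1 hs
  funext i
  exact (this i (Finset.mem_univ i)).symm

/-- The quadratic part of the balance equations. -/
noncomputable def balQ (m : ℕ) (l : ℕ → ℝ) (x : ℕ) : ℝ :=
  (∑ ξ ∈ Ioc x m, l ξ * l (ξ - x)) + l (x + 1) * (∑ ξ ∈ Ioc (x + 1) m, l ξ)

theorem balQ_nonneg (m : ℕ) (l : ℕ → ℝ) (hl : ∀ x, 0 ≤ l x) (x : ℕ) : 0 ≤ balQ m l x :=
  add_nonneg (Finset.sum_nonneg fun _ _ => mul_nonneg (hl _) (hl _))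
    (mul_nonneg (hl _) (Finset.sum_nonneg fun _ _ => hl _))

theorem balQ_sum_le (m : ℕ) (l : ℕ → ℝ) (hl : ∀ x, 0 ≤ l x) (hsup : ∀ x, x ∉ Icc 1 m → l x = 0)
    (hsum : ∑ x ∈ Icc 1 m, l x = 1) : ∑ x ∈ Icc 1 m, balQ m l x ≤ 1 := by
  have h1 : ∑ x ∈ Icc 1 m, ∑ ξ ∈ Ioc x m, l ξ * l (ξ - x) =
      ∑ ξ ∈ Icc 1 m, l ξ * ∑ y ∈ Ico 1 ξ, l y := by
    rw [Finset.sum_comm' (s' := fun ξ => Ico 1 ξ) (t' := Icc 1 m)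
      (by intro x y; simp only [mem_Icc, mem_Ioc, mem_Ico]; omega)]
    refine Finset.sum_congr rfl fun ξ hξ => ?_
    rw [Finset.mul_sum]
    refine Finset.sum_bij' (fun x _ => ξ - x) (fun x _ => ξ - x) ?_ ?_ ?_ ?_ ?_
    · intro x hx; simp only [mem_Ico] at hx ⊢; omega
    · intro x hx; simp only [mem_Ico] at hx ⊢; omega
    · intro x hx; simp only [mem_Ico] at hx; omega
    · intro x hx; simp only [mem_Ico] at hx; omega
    · intro x hx; rfl
  have h2 : ∑ x ∈ Icc 1 m, l (x + 1) * (∑ ξ ∈ Ioc (x + 1) m, l ξ) ≤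
      ∑ x ∈ Icc 1 m, l x * ∑ ξ ∈ Ioc x m, l ξ := by
    have e : ∑ x ∈ Icc 1 m, l (x + 1) * (∑ ξ ∈ Ioc (x + 1) m, l ξ) =
        ∑ x ∈ (Icc 1 m).image (· + 1), l x * ∑ ξ ∈ Ioc x m, l ξ := by
      rw [Finset.sum_image (by intro a _ b _ h; simpa using h)]
    rw [e]
    have e2 : ∑ x ∈ Icc 1 m, l x * ∑ ξ ∈ Ioc x m, l ξ =
        ∑ x ∈ Icc 1 (m + 1), l x * ∑ ξ ∈ Ioc x m, l ξ := by
      apply Finset.sum_subset (Finset.Icc_subset_Icc_right (Nat.le_succ m))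
      intro x _ hx
      rw [hsup x hx, zero_mul]
    rw [e2]
    apply Finset.sum_le_sum_of_subset_of_nonneg
    · intro x hx
      simp only [mem_image, mem_Icc] at hx ⊢
      omega
    · intro x _ _
      exact mul_nonneg (hl _) (Finset.sum_nonneg fun _ _ => hl _)
  have h3 : ∑ ξ ∈ Icc 1 m, l ξ * (∑ y ∈ Ico 1 ξ, l y + ∑ y ∈ Ioc ξ m, l y) ≤ 1 := by
    calc _ ≤ ∑ ξ ∈ Icc 1 m, l ξ * 1 := by
          refine Finset.sum_le_sum fun ξ hξ => mul_le_mul_of_nonneg_left ?_ (hl _)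
          rw [← Finset.sum_union (by
            rw [Finset.disjoint_left]; intro a; simp only [mem_Ico, mem_Ioc]; omega), ← hsum]
          apply Finset.sum_le_sum_of_subset_of_nonneg
          · intro x hx
            simp only [mem_union, mem_Ico, mem_Ioc, mem_Icc] at hx hξ ⊢
            omega
          · intro x _ _
            exact hl _
      _ = 1 := by simpa using hsum
  simp only [balQ, Finset.sum_add_distrib]
  simp only [mul_add, Finset.sum_add_distrib] at h3
  linarith

/-- Extension by zero. -/
noncomputable def balExt (m : ℕ) (v : Icc 1 m → ℝ) (x : ℕ) : ℝ :=
  if h : x ∈ Icc 1 m then v ⟨x, h⟩ else 0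

theorem balExt_continuous (m x : ℕ) : Continuous (fun v => balExt m v x) := by
  unfold balExt
  by_cases h : x ∈ Icc 1 m
  · simp only [h, dif_pos]
    exact continuous_apply _
  · simp only [h, dif_neg, not_false_eq_true]
    exact continuous_const

theorem balExt_sum (m : ℕ) (v : Icc 1 m → ℝ) : ∑ x ∈ Icc 1 m, balExt m v x = ∑ i, v i := by
  rw [← Finset.sum_coe_sort]
  refine Finset.sum_congr rfl fun i _ => ?_
  simp only [balExt, i.2, dif_pos]

theorem exists_balanced_aux (m : ℕ) (hm : 1 ≤ m) :
    ∃ (l : ℕ → ℝ) (ε : ℝ), (∀ x, 0 ≤ l x) ∧ (∑ x ∈ Icc 1 m, l x) = 1 ∧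
      (∀ x, x ∉ Icc 1 m → l x = 0) ∧ 0 < ε ∧ ∀ x ∈ Icc 1 m, l x = balQ m l x + ε := by
  have : Nonempty (Icc 1 m) := ⟨⟨1, by simp [hm]⟩⟩
  have hm0 : (0 : ℝ) < m := by exact_mod_cast hm
  let E : (Icc 1 m → ℝ) → ℝ := fun v => (1 - ∑ x ∈ Icc 1 m, balQ m (balExt m v) x) / m
  have hQc : ∀ x, Continuous (fun v => balQ m (balExt m v) x) := by
    intro x
    unfold balQ
    refine Continuous.add (continuous_finsetSum _ fun _ _ => ?_) (Continuous.mul ?_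
      (continuous_finsetSum _ fun _ _ => ?_))
    · exact (balExt_continuous m _).mul (balExt_continuous m _)
    · exact balExt_continuous m _
    · exact balExt_continuous m _
  have hEc : Continuous E := by
    refine Continuous.div_const (continuous_const.sub (continuous_finsetSum _ fun _ _ => hQc _)) _
  have hnn : ∀ v ∈ stdSimplex ℝ (Icc 1 m), ∀ x, 0 ≤ balExt m v x := by
    intro v hv x
    unfold balExt
    split_ifs
    · exact hv.1 _
    · exact le_rfl
  have hsup : ∀ v x, x ∉ Icc 1 m → balExt m v x = 0 := fun v x hx => by
    simp only [balExt, hx, dif_neg, not_false_eq_true]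
  have hE0 : ∀ v ∈ stdSimplex ℝ (Icc 1 m), 0 ≤ E v := by
    intro v hv
    refine div_nonneg ?_ hm0.le
    have := balQ_sum_le m (balExt m v) (hnn v hv) (hsup v) (by rw [balExt_sum, hv.2])
    linarith
  obtain ⟨v, hv, hfix⟩ := brouwer_simplex
    (fun v (i : Icc 1 m) => balQ m (balExt m v) i + E v)
    (continuous_pi fun i => (hQc _).add hEc)
    (by
      intro v hv
      refine ⟨fun i => add_nonneg (balQ_nonneg m _ (hnn v hv) _) (hE0 v hv), ?_⟩
      rw [Finset.sum_add_distrib, Finset.sum_coe_sort (Icc 1 m) (fun x => balQ m (balExt m v) x)]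
      simp only [Finset.sum_const, Finset.card_univ, Fintype.card_coe, Nat.card_Icc, nsmul_eq_mul,
        Nat.add_sub_cancel, E]
      field_simp
      ring)
  have heq : ∀ x ∈ Icc 1 m, balExt m v x = balQ m (balExt m v) x + E v := by
    intro x hx
    have := congrFun hfix ⟨x, hx⟩
    simp only at this
    rw [this]
    simp only [balExt, hx, dif_pos]
  have hone : ∑ x ∈ Icc 1 m, balExt m v x = 1 := by rw [balExt_sum, hv.2]
  refine ⟨balExt m v, E v, hnn v hv, hone, hsup v, ?_, heq⟩
  refine lt_of_le_of_ne (hE0 v hv) fun h0 => ?_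
  have hz : ∀ k x, m < x + k → balExt m v x = 0 := by
    intro k
    induction k with
    | zero =>
      intro x hx
      exact hsup v x (by simp only [mem_Icc]; omega)
    | succ k ih =>
      intro x hx
      by_cases hmem : x ∈ Icc 1 m
      · rw [heq x hmem, ← h0, balQ, ih (x + 1) (by omega), zero_mul, add_zero, add_zero]
        refine Finset.sum_eq_zero fun ξ hξ => ?_
        rw [ih ξ (by simp only [mem_Ioc] at hξ; omega), zero_mul]
      · exact hsup v x hmem
  rw [Finset.sum_eq_zero (fun x _ => hz (m + 1) x (by omega))] at hone
  exact zero_ne_one hone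

/-- For every `n ≥ 2` there is a probability distribution `ℓ` on `{1,…,n-1}` which is
balanced: the hitting probabilities `h` of greedy routing to `0` (with each vertex
independently receiving one shortcut of `ℓ`-distributed length) satisfy
`ℓ x = h x / ∑ ξ h ξ`. -/
theorem exists_balanced_distribution (n : ℕ) (hn : 2 ≤ n) :
    ∃ ℓ : ℕ → ℝ, (∀ x, 0 ≤ ℓ x) ∧ (∑ x ∈ Icc 1 (n - 1), ℓ x) = 1 ∧
      (∀ x, x ∉ Icc 1 (n - 1) → ℓ x = 0) ∧
      ∃ h : ℕ → ℝ, BackEq n ℓ h ∧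
        ∀ x ∈ Icc 1 (n - 1), ℓ x = h x / (∑ ξ ∈ Icc 1 (n - 1), h ξ) := by
  obtain ⟨l, ε, h1, h2, h3, hε, heq⟩ := exists_balanced_aux (n - 1) (by omega)
  have hn0 : (0 : ℝ) < (n : ℝ) - 1 := by
    have : (2 : ℝ) ≤ n := by exact_mod_cast hn
    linarith
  have hS : (0 : ℝ) < 1 / (((n : ℝ) - 1) * ε) := by positivity
  have hc : 1 / (((n : ℝ) - 1) * ε) * ε = 1 / ((n : ℝ) - 1) := by
    field_simp
  refine ⟨l, h1, h2, h3, fun x => 1 / (((n : ℝ) - 1) * ε) * l x, ⟨?_, ?_⟩, ?_⟩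
  · have hl : l (n - 1) = ε := by
      have hz : l (n - 1 + 1) = 0 := h3 _ (by simp only [mem_Icc]; omega)
      rw [heq (n - 1) (by simp only [mem_Icc]; omega), balQ, hz]
      simp
    simp only [hl, hc]
  · intro x hx1 hx2
    simp only
    rw [heq x (by simp only [mem_Icc]; omega), balQ, mul_add, hc, mul_add, Finset.mul_sum]
    simp only [mul_assoc]
  · intro x _
    rw [← Finset.mul_sum, h2, mul_one, mul_div_cancel_left₀ _ hS.ne']
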